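/- arXiv:1709.03377 — 5 statements merged into one kernel-verified Lean document; each statement's English description precedes it below -/
import Mathlib

section
/- If f : ℝ → ℂ is such that both f and x ↦ f(x)/x are integrable on ℝ, then lim_{A,B→∞} ∫_{-B}^{A} f̂(y) dy = 0, where f̂ is the Fourier transform of f. -/
open MeasureTheory Complex Filter

/-- Riemann-Lebesgue lemma for the Fourier integral with kernel `exp (-I x y)`. -/
theorem tendsto_integral_mul_exp_cocompact (f : ℝ → ℂ) :
    Tendsto (fun y : ℝ => ∫ x : ℝ, f x * Complex.exp (-(Complex.I * x * y)))
      (cocompact ℝ) (nhds 0) := by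
  have hscale : Tendsto (fun y : ℝ => y * (2 * Real.pi)⁻¹) (cocompact ℝ) (cocompact ℝ) :=
    (Homeomorph.mulRight₀ _ (by positivity : (2 * Real.pi)⁻¹ ≠ 0)).isClosedEmbedding
      |>.tendsto_cocompact
  refine ((Real.tendsto_integral_exp_smul_cocompact f).comp hscale).congr fun y => ?_
  refine integral_congr_ae (ae_of_all _ fun x => ?_)
  have hpi : (Real.pi : ℂ) ≠ 0 := by exact_mod_cast Real.pi_ne_zero
  simp only [Circle.smul_def, Real.fourierChar_apply, smul_eq_mul]
  rw [mul_comm]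
  congr 2
  push_cast
  field_simp

theorem norm_exp_neg_I_mul_mul (x y : ℝ) :
    ‖Complex.exp (-(Complex.I * x * y))‖ = 1 := by
  rw [show -(Complex.I * x * y) = ((-(x * y) : ℝ) : ℂ) * Complex.I by push_cast; ring]
  exact Complex.norm_exp_ofReal_mul_I _

theorem MeasureTheory.Integrable.mul_exp_neg_I_mul_mul {f : ℝ → ℂ} (hf : Integrable f) (y : ℝ) :
    Integrable fun x : ℝ => f x * Complex.exp (-(Complex.I * x * y)) :=
  hf.mul_bdd (c := 1) (by fun_prop) (ae_of_all _ fun x => (norm_exp_neg_I_mul_mul x y).le)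

theorem intervalIntegral_exp_neg_I_mul_mul {x : ℝ} (hx : x ≠ 0) (a b : ℝ) :
    ∫ y in a..b, Complex.exp (-(Complex.I * x * y)) =
      Complex.I * (Complex.exp (-(Complex.I * x * b)) - Complex.exp (-(Complex.I * x * a))) / x := by
  have hx' : (x : ℂ) ≠ 0 := by exact_mod_cast hx
  have hc : -(Complex.I * x) ≠ 0 := neg_ne_zero.2 (mul_ne_zero Complex.I_ne_zero hx')
  have h := integral_exp_mul_complex (a := a) (b := b) hc
  simp only [neg_mul] at h
  rw [h, div_eq_div_iff hc hx']
  linear_combination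
    (-(Complex.exp (-(Complex.I * x * b)) - Complex.exp (-(Complex.I * x * a))) * x) *
      (-Complex.I_sq)

/-- Integrating the Fourier transform of `f` over `[a, b]` yields the increment of the Fourier
transform of `f x / x`, up to the factor `I`. -/
theorem intervalIntegral_fourier_eq_sub {f : ℝ → ℂ} (hf : Integrable f)
    (hf' : Integrable (fun x : ℝ => f x / (x : ℂ))) (a b : ℝ) :
    ∫ y in a..b, ∫ x : ℝ, f x * Complex.exp (-(Complex.I * x * y)) =
      Complex.I * ((∫ x : ℝ, f x / x * Complex.exp (-(Complex.I * x * b))) -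
        ∫ x : ℝ, f x / x * Complex.exp (-(Complex.I * x * a))) := by
  have hprod : Integrable (Function.uncurry fun (y x : ℝ) =>
      f x * Complex.exp (-(Complex.I * x * y)))
      ((volume.restrict (Set.uIoc a b)).prod volume) := by
    have : IsFiniteMeasure (volume.restrict (Set.uIoc a b)) :=
      isFiniteMeasure_restrict.2 (by simp [Set.uIoc])
    refine (hf.comp_snd (volume.restrict (Set.uIoc a b))).mul_bdd (c := 1)
      (g := fun p : ℝ × ℝ => Complex.exp (-(Complex.I * p.2 * p.1))) ?_ ?_
    · exact Continuous.aestronglyMeasurable (by fun_prop)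
    · exact ae_of_all _ fun p => (norm_exp_neg_I_mul_mul p.2 p.1).le
  rw [intervalIntegral_integral_swap hprod, ← integral_sub (hf'.mul_exp_neg_I_mul_mul b)
    (hf'.mul_exp_neg_I_mul_mul a), ← integral_const_mul]
  refine integral_congr_ae ?_
  filter_upwards [compl_mem_ae_iff.2 (measure_singleton (μ := volume) (0 : ℝ))] with x hx
  rw [intervalIntegral.integral_const_mul, intervalIntegral_exp_neg_I_mul_mul hx]
  ring

/-- If `f` and `x ↦ f x / x` are both integrable on `ℝ`, then
`∫_{-B}^{A} f̂(y) dy → 0` as `A, B → ∞`. -/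
theorem integral_fourier_tendsto_zero (f : ℝ → ℂ) (hf : Integrable f)
    (hf' : Integrable (fun x : ℝ => f x / (x : ℂ))) :
    Tendsto (fun AB : ℝ × ℝ =>
        ∫ y in (-AB.2)..AB.1, ∫ x : ℝ, f x * Complex.exp (-(Complex.I * x * y)))
      (atTop ×ˢ atTop) (nhds 0) := by
  simp_rw [intervalIntegral_fourier_eq_sub hf hf']
  have h := tendsto_integral_mul_exp_cocompact fun x : ℝ => f x / x
  have hA := (h.mono_left atTop_le_cocompact).comp
    (tendsto_fst (f := atTop) (g := (atTop : Filter ℝ)))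
  have hB := (h.mono_left atBot_le_cocompact).comp
    (tendsto_neg_atTop_atBot.comp (tendsto_snd (f := (atTop : Filter ℝ)) (g := atTop)))
  simpa [Function.comp_def] using (hA.sub hB).const_mul Complex.I
end

section
/- If f ∈ L¹(ℝ) satisfies a Lipschitz condition of order α at a point t ∈ ℝ, i.e., there exist K > 0, α ∈ (0,1], and a neighborhood of t on which |f(x) − f(t)| ≤ K|x − t|^α, then f(t) = lim_{A,B→∞} (1/2π) ∫_{-B}^{A} f̂(y) e^{ity} dy, where f̂ is the Fourier transform of f. -/
open MeasureTheory Complex Filter Real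

/-- Riemann–Lebesgue lemma for the Fourier transform with kernel `e^{-ixy}`. -/
lemma tendsto_integral_mul_cexp_neg_cocompact (k : ℝ → ℂ) :
    Tendsto (fun y : ℝ => ∫ x : ℝ, k x * cexp (-(I * x * y))) (cocompact ℝ) (nhds 0) := by
  have hscale : Tendsto (fun y : ℝ => y / (2 * π)) (cocompact ℝ) (cocompact ℝ) := by
    simpa [div_eq_mul_inv] using
      (Homeomorph.mulRight₀ ((2 * π)⁻¹) (by positivity)).isClosedEmbedding.tendsto_cocompact
  refine ((Real.tendsto_integral_exp_smul_cocompact k).comp hscale).congr fun y => ?_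
  refine integral_congr_ae (Eventually.of_forall fun x => ?_)
  have hπ : (π : ℂ) ≠ 0 := by exact_mod_cast Real.pi_ne_zero
  simp only [Circle.smul_def, Real.fourierChar_apply, smul_eq_mul]
  rw [mul_comm]
  congr 2
  push_cast
  field_simp

lemma norm_cexp_neg_I_mul_mul (x y : ℝ) : ‖cexp (-(I * x * y))‖ = 1 := by
  rw [Complex.norm_exp]
  simp

lemma integrable_mul_cexp_neg {h : ℝ → ℂ} (hh : Integrable h) (y : ℝ) :
    Integrable fun x : ℝ => h x * cexp (-(I * x * y)) := by
  refine hh.mono (hh.1.mul (by fun_prop : Continuous _).aestronglyMeasurable)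
    (Eventually.of_forall fun x => ?_)
  rw [norm_mul, norm_cexp_neg_I_mul_mul, mul_one]

lemma continuous_integral_mul_cexp_neg {h : ℝ → ℂ} (hh : Integrable h) :
    Continuous fun y : ℝ => ∫ x : ℝ, h x * cexp (-(I * x * y)) := by
  refine continuous_of_dominated (fun y => (integrable_mul_cexp_neg hh y).1)
    (fun y => Eventually.of_forall fun x => ?_) hh.norm
    (Eventually.of_forall fun x => by fun_prop)
  rw [norm_mul, norm_cexp_neg_I_mul_mul, mul_one]

lemma hasDerivAt_integral_mul_cexp_neg {k : ℝ → ℂ} (hk : Integrable k)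
    (hxk : Integrable fun x : ℝ => (x : ℂ) * k x) (y : ℝ) :
    HasDerivAt (fun y : ℝ => ∫ x : ℝ, k x * cexp (-(I * x * y)))
      (-I * ∫ x : ℝ, (x * k x) * cexp (-(I * x * y))) y := by
  rw [← integral_const_mul]
  refine (hasDerivAt_integral_of_dominated_loc_of_deriv_le
    (F' := fun y x : ℝ => -I * ((x * k x) * cexp (-(I * x * y))))
    univ_mem (Eventually.of_forall fun y => (integrable_mul_cexp_neg hk y).1)
    (integrable_mul_cexp_neg hk y) ((integrable_mul_cexp_neg hxk y).const_mul _).1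
    (Eventually.of_forall fun x y _ => ?_) hxk.norm
    (Eventually.of_forall fun x y _ => ?_)).2
  · rw [norm_mul, norm_mul, norm_cexp_neg_I_mul_mul]
    simp
  · have h1 : HasDerivAt (fun y : ℝ => -(I * x * (y : ℂ))) (-(I * x * 1)) y :=
      ((hasDerivAt_id y).ofReal_comp.const_mul (I * x)).neg
    convert! h1.cexp.const_mul (k x) using 1
    ring

/-- If `h(0) = 0` and `h(x) / x` is integrable then the inversion integral of `h` at `0`
tends to `0`. -/
lemma tendsto_intervalIntegral_fourier_zero {h : ℝ → ℂ} (hh : Integrable h) (h0 : h 0 = 0)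
    (hk : Integrable fun x : ℝ => h x / x) :
    Tendsto (fun AB : ℝ × ℝ => ∫ y in (-AB.2)..AB.1, ∫ x : ℝ, h x * cexp (-(I * x * y)))
      (atTop ×ˢ atTop) (nhds 0) := by
  have hxk : (fun x : ℝ => (x : ℂ) * (h x / x)) = h := by
    ext x
    rcases eq_or_ne x 0 with rfl | hx
    · simp [h0]
    · have : (x : ℂ) ≠ 0 := by exact_mod_cast hx
      field_simp
  set φ : ℝ → ℂ := fun y => ∫ x : ℝ, (h x / x) * cexp (-(I * x * y)) with hφ
  have hder (y : ℝ) : HasDerivAt (fun y => I * φ y) (∫ x : ℝ, h x * cexp (-(I * x * y))) y := by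
    have := (hasDerivAt_integral_mul_cexp_neg hk (by rwa [hxk]) y).const_mul I
    simp only [fun x : ℝ => congrFun hxk x, ← mul_assoc, mul_neg, I_mul_I, neg_neg,
      one_mul] at this
    exact this
  have hlim := tendsto_integral_mul_cexp_neg_cocompact fun x : ℝ => h x / x
  have hA : Tendsto (fun AB : ℝ × ℝ => φ AB.1) (atTop ×ˢ atTop) (nhds 0) :=
    (hlim.mono_left atTop_le_cocompact).comp tendsto_fst
  have hB : Tendsto (fun AB : ℝ × ℝ => φ (-AB.2)) (atTop ×ˢ atTop) (nhds 0) :=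
    (hlim.mono_left atBot_le_cocompact).comp (tendsto_neg_atTop_atBot.comp tendsto_snd)
  have := (hA.const_mul I).sub (hB.const_mul I)
  rw [mul_zero, sub_zero] at this
  refine this.congr fun AB => ?_
  exact (intervalIntegral.integral_eq_sub_of_hasDerivAt (fun y _ => hder y)
    ((continuous_integral_mul_cexp_neg hh).intervalIntegrable _ _)).symm

lemma integrable_div_of_norm_le_rpow {h : ℝ → ℂ} (hh : Integrable h) {C α δ : ℝ} (hα : 0 < α)
    (hδ : 0 < δ) (hle : ∀ x : ℝ, |x| < δ → ‖h x‖ ≤ C * |x| ^ α) :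
    Integrable fun x : ℝ => h x / x := by
  have hmeas : AEStronglyMeasurable (fun x : ℝ => h x / x) := by
    have : AEMeasurable (fun x : ℝ => h x / x) :=
      hh.1.aemeasurable.div (by fun_prop)
    exact this.aestronglyMeasurable
  have hpow : IntegrableOn (fun x : ℝ => |x| ^ (α - 1)) (Set.Ioc (-δ) δ) := by
    rw [← intervalIntegrable_iff_integrableOn_Ioc_of_le (by linarith)]
    refine intervalIntegrable_of_even (fun x => by rw [abs_neg]) fun x hx => ?_
    refine (intervalIntegral.intervalIntegrable_rpow' (r := α - 1) (by linarith)).congr ?_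
    intro y hy
    rw [Set.uIoc_of_le hx.le] at hy
    simp only [abs_of_pos hy.1]
  have hnear : IntegrableOn (fun x : ℝ => h x / x) (Set.Ioo (-δ) δ) := by
    refine Integrable.mono' ((hpow.mono_set Set.Ioo_subset_Ioc_self).const_mul C)
      hmeas.restrict ?_
    filter_upwards [ae_restrict_mem measurableSet_Ioo, (measure_eq_zero_iff_ae_notMem.mp
      (measure_singleton (0 : ℝ))).filter_mono (ae_mono Measure.restrict_le_self)] with x hx hx0
    have hx0 : 0 < |x| := abs_pos.mpr hx0
    rw [norm_div, Complex.norm_real, Real.norm_eq_abs, Real.rpow_sub_one hx0.ne', ← mul_div_assoc]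
    gcongr
    exact hle x (abs_lt.mpr hx)
  have hfar : IntegrableOn (fun x : ℝ => h x / x) (Set.Ioo (-δ) δ)ᶜ := by
    refine Integrable.mono' (hh.norm.const_mul δ⁻¹).integrableOn hmeas.restrict ?_
    filter_upwards [ae_restrict_mem measurableSet_Ioo.compl] with x hx
    have hx : δ ≤ |x| := not_lt.mp fun h' => hx (abs_lt.mp h')
    rw [norm_div, Complex.norm_real, Real.norm_eq_abs, div_eq_inv_mul]
    gcongr
  exact integrableOn_univ.mp (Set.union_compl_self (Set.Ioo (-δ) δ) ▸ hnear.union hfar)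

lemma integral_gaussian_mul_cexp_neg (y : ℝ) :
    ∫ x : ℝ, cexp (-(1 / 2) * x ^ 2) * cexp (-(I * x * y)) =
      (2 * π : ℂ) ^ (1 / 2 : ℂ) * cexp (-(1 / 2) * y ^ 2) := by
  have hgauss := fourierIntegral_gaussian (b := 1 / 2) (by norm_num) (-y)
  rw [show (π : ℂ) / (1 / 2) = 2 * π by ring,
    show -(-(y : ℂ)) ^ 2 / (4 * (1 / 2)) = -(1 / 2) * y ^ 2 by ring] at hgauss
  rw [← hgauss]
  refine integral_congr_ae (Eventually.of_forall fun x => ?_)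
  simp only
  rw [mul_comm, show -(I * x * y) = I * -y * x by ring]

lemma tendsto_intervalIntegral_fourier_gaussian :
    Tendsto (fun AB : ℝ × ℝ => ∫ y in (-AB.2)..AB.1,
      ∫ x : ℝ, cexp (-(1 / 2) * x ^ 2) * cexp (-(I * x * y))) (atTop ×ˢ atTop)
      (nhds (2 * π)) := by
  simp only [integral_gaussian_mul_cexp_neg]
  have hint : Integrable fun y : ℝ => (2 * π : ℂ) ^ (1 / 2 : ℂ) * cexp (-(1 / 2) * y ^ 2) :=
    (integrable_cexp_neg_mul_sq (b := 1 / 2) (by norm_num)).const_mul _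
  have hval : ∫ y : ℝ, (2 * π : ℂ) ^ (1 / 2 : ℂ) * cexp (-(1 / 2) * y ^ 2) = 2 * π := by
    have hπ : (2 * π : ℂ) ≠ 0 := mul_ne_zero two_ne_zero (by exact_mod_cast Real.pi_ne_zero)
    rw [integral_const_mul, integral_gaussian_complex (by norm_num),
      show (π : ℂ) / (1 / 2) = 2 * π by ring, ← Complex.cpow_add _ _ hπ]
    rw [show (1 / 2 + 1 / 2 : ℂ) = 1 by ring, Complex.cpow_one]
  have hlim := intervalIntegral_tendsto_integral hint
    (tendsto_neg_atTop_atBot.comp (tendsto_snd (f := (atTop : Filter ℝ)) (g := atTop)))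
    tendsto_fst
  rw [hval] at hlim
  exact hlim

lemma norm_one_sub_gaussian_le (x : ℝ) : ‖1 - cexp (-(1 / 2) * x ^ 2)‖ ≤ x ^ 2 := by
  have h1 : (1 : ℂ) - cexp (-(1 / 2) * x ^ 2) = ((1 - rexp (-(1 / 2) * x ^ 2) : ℝ) : ℂ) := by
    push_cast; rfl
  have h2 := Real.add_one_le_exp (-(1 / 2) * x ^ 2)
  have h3 : rexp (-(1 / 2) * x ^ 2) ≤ 1 := Real.exp_le_one_iff.mpr (by nlinarith [sq_nonneg x])
  rw [h1, Complex.norm_real, Real.norm_eq_abs, abs_of_nonneg (by linarith)]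
  nlinarith [sq_nonneg x]

/-- The inversion formula at `0`. -/
lemma tendsto_intervalIntegral_fourier_of_norm_sub_le {f : ℝ → ℂ} (hf : Integrable f)
    {K α ε : ℝ} (hα : 0 < α) (hα1 : α ≤ 1) (hε : 0 < ε)
    (hle : ∀ x : ℝ, |x| < ε → ‖f x - f 0‖ ≤ K * |x| ^ α) :
    Tendsto (fun AB : ℝ × ℝ => ∫ y in (-AB.2)..AB.1, ∫ x : ℝ, f x * cexp (-(I * x * y)))
      (atTop ×ˢ atTop) (nhds (2 * π * f 0)) := by
  set g : ℝ → ℂ := fun x => cexp (-(1 / 2) * x ^ 2) with hg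
  have hgi : Integrable g := integrable_cexp_neg_mul_sq (b := 1 / 2) (by norm_num)
  set h : ℝ → ℂ := fun x => f x - f 0 * g x with hh
  have hhi : Integrable h := hf.sub (hgi.const_mul _)
  have hbound : ∀ x : ℝ, |x| < min ε 1 → ‖h x‖ ≤ (K + ‖f 0‖) * |x| ^ α := by
    intro x hx
    obtain ⟨hxε, hx1⟩ := lt_min_iff.mp hx
    have hsq : x ^ 2 ≤ |x| ^ α := by
      rw [← sq_abs, ← Real.rpow_natCast]
      exact Real.rpow_le_rpow_of_exponent_ge_of_imp (abs_nonneg x) hx1.le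
        (by push_cast; linarith) fun _ h' => absurd h' (by norm_num)
    calc ‖h x‖ = ‖(f x - f 0) + f 0 * (1 - g x)‖ := by simp only [hh]; congr 1; ring
      _ ≤ ‖f x - f 0‖ + ‖f 0‖ * ‖1 - g x‖ := (norm_add_le _ _).trans_eq (by rw [norm_mul])
      _ ≤ K * |x| ^ α + ‖f 0‖ * |x| ^ α := by
        gcongr
        · exact hle x hxε
        · exact (norm_one_sub_gaussian_le x).trans hsq
      _ = _ := by ring
  have hlim := (tendsto_intervalIntegral_fourier_zero hhi (by simp [hh, hg])
    (integrable_div_of_norm_le_rpow hhi hα (lt_min hε one_pos) hbound)).add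
    (tendsto_intervalIntegral_fourier_gaussian.const_mul (f 0))
  rw [zero_add, mul_comm] at hlim
  refine hlim.congr fun AB => ?_
  rw [← intervalIntegral.integral_const_mul, ← intervalIntegral.integral_add
    ((continuous_integral_mul_cexp_neg hhi).intervalIntegrable _ _)
    (((continuous_integral_mul_cexp_neg hgi).intervalIntegrable _ _).const_mul _)]
  refine intervalIntegral.integral_congr fun y _ => ?_
  rw [← integral_const_mul, ← integral_add (integrable_mul_cexp_neg hhi y)
    ((integrable_mul_cexp_neg hgi y).const_mul _)]
  refine integral_congr_ae (Eventually.of_forall fun x => ?_)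
  simp only [hh, hg]
  ring

/-- If `f ∈ L¹(ℝ)` satisfies a Lipschitz condition of order `α ∈ (0,1]` at `t`, then
`f t = lim_{A,B→∞} (1/(2π)) ∫_{-B}^{A} f̂(y) e^{ity} dy`. -/
theorem fourier_inversion_at_lipschitz_point (f : ℝ → ℂ) (hf : Integrable f) (t : ℝ)
    (hlip : ∃ K > (0 : ℝ), ∃ α : ℝ, 0 < α ∧ α ≤ 1 ∧ ∃ ε > (0 : ℝ),
      ∀ x : ℝ, |x - t| < ε → ‖f x - f t‖ ≤ K * |x - t| ^ α) :
    Tendsto (fun AB : ℝ × ℝ =>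
        (1 / (2 * (π : ℂ))) * ∫ y in (-AB.2)..AB.1,
          (∫ x : ℝ, f x * Complex.exp (-(Complex.I * x * y))) * Complex.exp (Complex.I * t * y))
      (atTop ×ˢ atTop) (nhds (f t)) := by
  obtain ⟨K, -, α, hα, hα1, ε, hε, hle⟩ := hlip
  have hlim := (tendsto_intervalIntegral_fourier_of_norm_sub_le (f := fun x => f (x + t))
    (hf.comp_add_right t) hα hα1 hε fun x hx => by
      simpa using hle (x + t) (by simpa using hx)).const_mul (1 / (2 * (π : ℂ)))
  have hπ : (π : ℂ) ≠ 0 := by exact_mod_cast Real.pi_ne_zero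
  rw [zero_add, show 1 / (2 * (π : ℂ)) * (2 * π * f t) = f t by field_simp] at hlim
  refine hlim.congr fun AB => ?_
  congr 1
  refine intervalIntegral.integral_congr fun y _ => ?_
  rw [← integral_mul_const]
  refine Eq.trans ?_ (integral_add_right_eq_self
    (fun x : ℝ => f x * cexp (-(I * x * y)) * cexp (I * t * y)) t)
  refine integral_congr_ae (Eventually.of_forall fun x => ?_)
  simp only [mul_assoc, ← Complex.exp_add]
  congr 2
  push_cast
  ring
end

section
/- (Uniqueness Theorem for L¹) If f ∈ L¹(ℝ) and f̂(y) = 0 for every y ∈ ℝ, then f = 0 almost everywhere. -/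
open MeasureTheory Complex Filter

open scoped FourierTransform SchwartzMap ContDiff in
/-- An integrable function on `ℝ` whose Fourier transform vanishes is zero almost everywhere. -/
theorem ae_eq_zero_of_fourier_eq_zero {f : ℝ → ℂ} (hf : Integrable f)
    (h : ∀ w : ℝ, 𝓕 f w = 0) : ∀ᵐ x : ℝ, f x = 0 := by
  refine ae_eq_zero_of_integral_contDiff_smul_eq_zero hf.locallyIntegrable fun g hg hgc ↦ ?_
  have hgc' : HasCompactSupport (Complex.ofRealCLM ∘ g) := hgc.comp_left rfl
  have hg' : ContDiff ℝ ∞ (Complex.ofRealCLM ∘ g) := by fun_prop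
  let φ : 𝓢(ℝ, ℂ) := hgc'.toSchwartzMap hg'
  let ψ : 𝓢(ℝ, ℂ) := 𝓕⁻ φ
  have hψ : 𝓕 (ψ : ℝ → ℂ) = φ := by
    rw [← SchwartzMap.fourier_coe, FourierTransform.fourier_fourierInv_eq]
  calc ∫ x, g x • f x = ∫ x, f x • 𝓕 (ψ : ℝ → ℂ) x := by
        simp [hψ, φ, mul_comm]
    _ = ∫ w, 𝓕 f w • ψ w := by
        have key := VectorFourier.integral_fourierIntegral_smul_eq_flip (μ := volume) (ν := volume)
          (L := innerₗ ℝ) Real.continuous_fourierChar continuous_inner hf ψ.integrable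
        rw [flip_innerₗ] at key
        exact key.symm
    _ = 0 := by simp [h]

/-- Uniqueness theorem: if `f ∈ L¹(ℝ)` and `f̂ = 0` everywhere, then `f = 0` a.e. -/
theorem fourier_uniqueness (f : ℝ → ℂ) (hf : Integrable f)
    (h : ∀ y : ℝ, (∫ x : ℝ, f x * Complex.exp (-(Complex.I * x * y))) = 0) :
    ∀ᵐ x : ℝ, f x = 0 := by
  refine ae_eq_zero_of_fourier_eq_zero hf fun w ↦ ?_
  rw [Real.fourier_real_eq_integral_exp_smul, ← h (2 * Real.pi * w)]
  refine integral_congr_ae (.of_forall fun x ↦ ?_)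
  simp only [smul_eq_mul]
  rw [mul_comm]
  congr 2
  push_cast
  ring
end

section
/- (Uniqueness Theorem for measures) Let μ be a complex regular Borel measure on ℝ with |μ|(ℝ) < ∞, and let μ̂(y) = ∫_{-∞}^{∞} e^{ixy} dμ(x) be its Fourier–Stieltjes transform. If μ̂(y) = 0 for almost every y ∈ ℝ, then μ = 0. -/
open MeasureTheory Complex Filter

/-- The Fourier–Stieltjes transform of a complex (Borel) measure `μ` on `ℝ`,
`μ̂(y) = ∫ e^{ixy} dμ(x)`, computed via the Jordan decompositions of the real and
imaginary parts of `μ`. -/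
noncomputable def fourierStieltjes (μ : MeasureTheory.ComplexMeasure ℝ) (y : ℝ) : ℂ :=
  ((∫ x : ℝ, Complex.exp (Complex.I * x * y) ∂μ.re.toJordanDecomposition.posPart) -
      ∫ x : ℝ, Complex.exp (Complex.I * x * y) ∂μ.re.toJordanDecomposition.negPart) +
    Complex.I *
      ((∫ x : ℝ, Complex.exp (Complex.I * x * y) ∂μ.im.toJordanDecomposition.posPart) -
        ∫ x : ℝ, Complex.exp (Complex.I * x * y) ∂μ.im.toJordanDecomposition.negPart)

theorem fourierStieltjes_eq_charFun (μ : ComplexMeasure ℝ) (y : ℝ) :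
    fourierStieltjes μ y =
      (charFun μ.re.toJordanDecomposition.posPart y -
          charFun μ.re.toJordanDecomposition.negPart y) +
        I * (charFun μ.im.toJordanDecomposition.posPart y -
          charFun μ.im.toJordanDecomposition.negPart y) := by
  have hexp (x : ℝ) : exp (I * x * y) = exp (y * x * I) := by ring_nf
  simp only [fourierStieltjes, charFun_apply_real, hexp]

theorem continuous_fourierStieltjes (μ : ComplexMeasure ℝ) : Continuous (fourierStieltjes μ) := by
  rw [funext (fourierStieltjes_eq_charFun μ)]
  exact (continuous_charFun.sub continuous_charFun).add
    (continuous_const.mul (continuous_charFun.sub continuous_charFun))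

/-- A signed measure on `ℝ` whose positive and negative parts have the same characteristic
function is zero. -/
theorem signedMeasure_eq_zero_of_charFun_eq (s : SignedMeasure ℝ)
    (h : charFun s.toJordanDecomposition.posPart = charFun s.toJordanDecomposition.negPart) :
    s = 0 := by
  rw [← s.toSignedMeasure_toJordanDecomposition, JordanDecomposition.toSignedMeasure]
  simp only [Measure.ext_of_charFun h, sub_self]

/-- Uniqueness theorem for measures: if the Fourier–Stieltjes transform of a complex
regular Borel measure `μ` on `ℝ` vanishes almost everywhere, then `μ = 0`. -/
theorem fourierStieltjes_uniqueness (μ : MeasureTheory.ComplexMeasure ℝ)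
    (h : ∀ᵐ y : ℝ, fourierStieltjes μ y = 0) : μ = 0 := by
  have h0 : ∀ y, fourierStieltjes μ y = 0 :=
    congrFun (((continuous_fourierStieltjes μ).ae_eq_iff_eq volume continuous_const).1 h)
  simp only [fourierStieltjes_eq_charFun] at h0
  have hconj (y : ℝ) := congrArg (starRingEnd ℂ) (h0 (-y))
  simp only [charFun_neg, map_add, map_sub, map_mul, conj_I, conj_conj, map_zero] at hconj
  have hre : μ.re = 0 := signedMeasure_eq_zero_of_charFun_eq _ <| funext fun y => by
    linear_combination (h0 y + hconj y) / 2
  have him : μ.im = 0 := signedMeasure_eq_zero_of_charFun_eq _ <| funext fun y => by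
    linear_combination (hconj y - h0 y) * I / 2 + I_sq *
      (charFun μ.im.toJordanDecomposition.posPart y - charFun μ.im.toJordanDecomposition.negPart y)
  exact ComplexMeasure.equivSignedMeasure.injective <| Prod.ext
    (hre.trans (map_zero ComplexMeasure.re).symm) (him.trans (map_zero ComplexMeasure.im).symm)
end

section
/- If f ∈ L¹(ℝ) is continuous at x = 0 and its Fourier transform satisfies f̂(y) ≥ 0 for all y (in particular f̂ is real-valued and nonnegative), then f̂ ∈ L¹(ℝ), f(x) = (1/2π) ∫_{-∞}^{∞} f̂(y) e^{ixy} dy for almost every x, and f(0) = (1/2π) ∫_{-∞}^{∞} f̂(y) dy. -/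
open MeasureTheory Complex Filter Real

open Module
open scoped Topology FourierTransform RealInnerProductSpace

section InnerProductSpace

variable {V : Type*} [NormedAddCommGroup V] [InnerProductSpace ℝ V]
  [MeasurableSpace V] [BorelSpace V] [FiniteDimensional ℝ V]

/-- At a continuity point of an integrable function, the Gauss means of its inverse Fourier
integral converge to the value of the function. -/
theorem tendsto_integral_gaussian_smul_fourier {f : V → ℂ} (hf : Integrable f) {v : V}
    (hv : ContinuousAt f v) :
    Tendsto (fun c : ℝ ↦ ∫ w : V, cexp (- c⁻¹ * ‖w‖ ^ 2 + 2 * π * I * ⟪v, w⟫) • 𝓕 f w)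
      atTop (𝓝 (f v)) := by
  refine (Real.tendsto_integral_gaussian_smul' hf hv).congr' ?_
  filter_upwards [Ioi_mem_atTop 0] with c (hc : 0 < c)
  have J : Integrable (fun w ↦ cexp (- c⁻¹ * ‖w‖ ^ 2 + 2 * π * I * ⟪v, w⟫)) :=
    GaussianFourier.integrable_cexp_neg_mul_sq_norm_add (by simpa) _ _
  have key : ∫ w : V, 𝓕 (fun w ↦ cexp (- c⁻¹ * ‖w‖ ^ 2 + 2 * π * I * ⟪v, w⟫)) w • f w =
      ∫ w : V, cexp (- c⁻¹ * ‖w‖ ^ 2 + 2 * π * I * ⟪v, w⟫) • 𝓕 f w := by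
    simpa using! VectorFourier.integral_fourierIntegral_smul_eq_flip (L := innerₗ V)
      Real.continuous_fourierChar continuous_inner J hf
  rw [← key]
  congr with w
  rw [fourier_gaussian_innerProductSpace' (by simpa), Complex.ofReal_inv, div_inv_eq_mul, div_inv_eq_mul,
    mul_right_comm]

theorem continuous_fourier_of_integrable {f : V → ℂ} (hf : Integrable f) :
    Continuous (𝓕 f) :=
  VectorFourier.fourierIntegral_continuous Real.continuous_fourierChar continuous_inner hf

theorem norm_fourier_le_integral_norm (f : V → ℂ) (w : V) : ‖𝓕 f w‖ ≤ ∫ v, ‖f v‖ :=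
  VectorFourier.norm_fourierIntegral_le_integral_norm _ _ _ _ _

/-- Almost everywhere Fourier inversion. -/
theorem fourierInv_fourier_ae_eq {f : V → ℂ} (hf : Integrable f) (hf' : Integrable (𝓕 f)) :
    ∀ᵐ x, f x = 𝓕⁻ (𝓕 f) x := by
  have hcont : Continuous (𝓕⁻ (𝓕 f)) := by
    rw [show 𝓕⁻ (𝓕 f) = fun x ↦ 𝓕 (𝓕 f) (-x) from funext (Real.fourierInv_eq_fourier_neg _)]
    exact (continuous_fourier_of_integrable hf').comp continuous_neg
  refine ae_eq_of_integral_contDiff_smul_eq hf.locallyIntegrable hcont.locallyIntegrable ?_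
  intro g hg hgc
  have hgc' : HasCompactSupport (Complex.ofRealCLM ∘ g) := hgc.comp_left rfl
  let φ : SchwartzMap V ℂ := hgc'.toSchwartzMap (by fun_prop)
  have hφ (x : V) : φ x = (g x : ℂ) := rfl
  have h₁ : ∫ x, 𝓕 (𝓕⁻ φ) x • f x = ∫ x, (𝓕⁻ φ) x • 𝓕 f x := by
    rw [SchwartzMap.fourier_coe]
    have := VectorFourier.integral_fourierIntegral_smul_eq_flip (L := innerₗ V)
      Real.continuous_fourierChar continuous_inner
      (SchwartzMap.integrable (μ := volume) (𝓕⁻ φ)) hf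
    rwa [flip_innerₗ] at this
  have h₂ : ∫ x, (𝓕⁻ φ) x • 𝓕 f x = ∫ x, φ x • 𝓕⁻ (𝓕 f) x := by
    rw [SchwartzMap.fourierInv_coe]
    have hflip : (-innerₗ V).flip = -innerₗ V := by ext; simp [real_inner_comm]
    have := VectorFourier.integral_fourierIntegral_smul_eq_flip (L := -innerₗ V)
      Real.continuous_fourierChar continuous_inner.neg (φ.integrable (μ := volume)) hf'
    rwa [hflip] at this
  rw [FourierTransform.fourier_fourierInv_eq, h₂] at h₁
  simpa [hφ] using h₁

end InnerProductSpace

/-- An integrable function that is continuous at `0` and has nonnegative Fourier transform has an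
integrable Fourier transform. -/
theorem integrable_fourier_of_nonneg {f : ℝ → ℂ} (hf : Integrable f) (hcont : ContinuousAt f 0)
    (hre : ∀ y, 0 ≤ (𝓕 f y).re) (him : ∀ y, (𝓕 f y).im = 0) : Integrable (𝓕 f) := by
  have hreal (y : ℝ) : (((𝓕 f y).re : ℝ) : ℂ) = 𝓕 f y := by
    apply Complex.ext <;> simp [him]
  have hFc := continuous_fourier_of_integrable hf
  let G : ℕ → ℝ → ℝ := fun n y ↦ rexp (-((n : ℝ) + 1)⁻¹ * y ^ 2) * (𝓕 f y).re
  have hGc (n : ℕ) : Continuous (G n) := by fun_prop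
  have hG0 (n : ℕ) (y : ℝ) : 0 ≤ G n y := mul_nonneg (exp_pos _).le (hre y)
  have hGint (n : ℕ) : Integrable (G n) := by
    refine (integrable_exp_neg_mul_sq (b := ((n : ℝ) + 1)⁻¹) (by positivity)).mul_bdd
      (c := ∫ v, ‖f v‖) (by fun_prop) (.of_forall fun y ↦ ?_)
    exact (Complex.abs_re_le_norm _).trans (norm_fourier_le_integral_norm f y)
  have hlim : Tendsto (fun n ↦ ∫ y, G n y) atTop (𝓝 (f 0).re) := by
    have h := (Complex.continuous_re.tendsto _).comp
      ((tendsto_integral_gaussian_smul_fourier hf hcont).comp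
        (tendsto_atTop_add_const_right _ (1 : ℝ) tendsto_natCast_atTop_atTop))
    refine h.congr fun n ↦ ?_
    rw [← Complex.ofReal_re (∫ y, G n y), ← integral_complex_ofReal]
    simp only [Function.comp_apply]
    congr 2 with y
    simp only [G, Complex.ofReal_mul, hreal]
    simp [← Complex.ofReal_pow]
  have hre_int : Integrable (fun y ↦ (𝓕 f y).re) := by
    refine integrable_of_tendsto (G := G) (.of_forall fun y ↦ ?_)
      (fun n ↦ (hGc n).aestronglyMeasurable) ?_
    · have h0 : Tendsto (fun n : ℕ ↦ ((n : ℝ) + 1)⁻¹) atTop (𝓝 0) := by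
        simpa using tendsto_one_div_add_atTop_nhds_zero_nat (𝕜 := ℝ)
      simpa [G] using ((h0.neg.mul_const (y ^ 2)).rexp).mul_const (𝓕 f y).re
    · have hval (n : ℕ) : ∫⁻ y, ‖G n y‖ₑ = ENNReal.ofReal (∫ y, G n y) := by
        rw [ofReal_integral_eq_lintegral_ofReal (hGint n) (.of_forall (hG0 n))]
        simp only [Real.enorm_of_nonneg (hG0 n _)]
      simp only [hval]
      rw [(ENNReal.tendsto_ofReal hlim).liminf_eq]
      exact ENNReal.ofReal_ne_top
  exact hre_int.ofReal.congr (.of_forall hreal)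

/-- If `f ∈ L¹(ℝ)` is continuous at `0` and `f̂ ≥ 0` (real-valued and nonnegative),
then `f̂ ∈ L¹(ℝ)`, the inversion formula holds a.e., and
`f 0 = (1/(2π)) ∫ f̂(y) dy`. -/
theorem fourier_nonneg_inversion (f : ℝ → ℂ) (hf : Integrable f)
    (hcont : ContinuousAt f 0)
    (hpos : ∀ y : ℝ,
      0 ≤ (∫ x : ℝ, f x * Complex.exp (-(Complex.I * x * y))).re ∧
      (∫ x : ℝ, f x * Complex.exp (-(Complex.I * x * y))).im = 0) :
    Integrable (fun y : ℝ => ∫ x : ℝ, f x * Complex.exp (-(Complex.I * x * y))) ∧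
    (∀ᵐ x : ℝ, f x = (1 / (2 * (π : ℂ))) *
      ∫ y : ℝ, (∫ x' : ℝ, f x' * Complex.exp (-(Complex.I * x' * y))) *
        Complex.exp (Complex.I * x * y)) ∧
    f 0 = (1 / (2 * (π : ℂ))) *
      ∫ y : ℝ, ∫ x : ℝ, f x * Complex.exp (-(Complex.I * x * y)) := by
  have hscale (y : ℝ) :
      ∫ x : ℝ, f x * Complex.exp (-(Complex.I * x * y)) = 𝓕 f (y / (2 * π)) := by
    rw [Real.fourier_real_eq_integral_exp_smul]
    congr with x
    rw [smul_eq_mul, mul_comm]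
    congr 2
    push_cast
    field_simp
  have hpi : 2 * π ≠ 0 := by positivity
  simp only [hscale] at hpos ⊢
  have hpos' (y : ℝ) : 0 ≤ (𝓕 f y).re ∧ (𝓕 f y).im = 0 := by
    simpa [mul_div_cancel_right₀ y hpi] using hpos (y * (2 * π))
  have hint : Integrable (𝓕 f) :=
    integrable_fourier_of_nonneg hf hcont (fun y ↦ (hpos' y).1) fun y ↦ (hpos' y).2
  have hinv (x : ℝ) : 𝓕⁻ (𝓕 f) x = (1 / (2 * (π : ℂ))) *
      ∫ y : ℝ, 𝓕 f (y / (2 * π)) * Complex.exp (Complex.I * x * y) := by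
    have h := Measure.integral_comp_div
      (fun y : ℝ ↦ 𝓕 f y * Complex.exp (Complex.I * x * (y * (2 * π)))) (2 * π)
    have h' (y : ℝ) : ((y / (2 * π) : ℝ) : ℂ) * (2 * π) = y := by
      push_cast
      field_simp
    simp only [h'] at h
    rw [h, abs_of_pos (by positivity), Complex.real_smul, ← mul_assoc, Real.fourierInv_eq']
    push_cast
    rw [one_div_mul_cancel (by exact_mod_cast hpi), one_mul]
    congr with y
    rw [smul_eq_mul, mul_comm]
    congr 2
    simp
    ring
  refine ⟨hint.comp_div hpi, ?_, ?_⟩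
  · filter_upwards [fourierInv_fourier_ae_eq hf hint] with x hx
    rw [hx, hinv]
  · rw [← hf.fourierInv_fourier_eq hint hcont, hinv]
    simp
end
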